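/- Fix m ∈ (0,1) and set β_c := 2(1−m²)^{-1}√I(m). Then limsup_{ε→0} limsup_{N→∞} E[(1/N) log Z^{≤ε}_{N,β,m}] ≤ 0 for all β < β_c, and limsup_{ε→0} limsup_{N→∞} E[(1/N) log Z^{≤ε}_{N,β,m}] ≤ −(1/4)(β−β_c)²(1−m²)² for all β ≥ β_c. -/

import Mathlib

open MeasureTheory ProbabilityTheory Real Filter
open scoped NNReal

noncomputable section

/-- The law of the i.i.d. Gaussian couplings `(g_{ij})_{1 ≤ i,j ≤ N}`, each `N(0, 1/N)`. -/
def couplings (N : ℕ) : Measure (Fin N × Fin N → ℝ) :=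
  Measure.pi fun _ : Fin N × Fin N => gaussianReal 0 ((N : ℝ≥0))⁻¹

/-- The spin value (`±1`) encoded by a Boolean. -/
def spin (b : Bool) : ℝ := if b then 1 else -1

/-- The base product measure weight `p_m(σ) = ∏ i, (1 + m σ_i)/2`. -/
def pm (N : ℕ) (m : ℝ) (σ : Fin N → Bool) : ℝ :=
  ∏ i : Fin N, (1 + m * spin (σ i)) / 2

/-- The Hamiltonian `H_{N,β,m}(σ)`. -/
def ham (N : ℕ) (β m : ℝ) (g : Fin N × Fin N → ℝ) (σ : Fin N → Bool) : ℝ :=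
  (β / Real.sqrt 2) * ∑ i : Fin N, ∑ j : Fin N,
      g (i, j) * (spin (σ i) - m) * (spin (σ j) - m)
    - (β ^ 2 / (4 * N)) * ∑ i : Fin N, ∑ j : Fin N,
      (spin (σ i) - m) ^ 2 * (spin (σ j) - m) ^ 2

/-- The partition function `Z_{N,β,m}`. -/
def Z (N : ℕ) (β m : ℝ) (g : Fin N × Fin N → ℝ) : ℝ :=
  ∑ σ : Fin N → Bool, pm N m σ * Real.exp (ham N β m g σ)

/-- The set `S_{N,m,ε}` of configurations whose empirical magnetization is `ε`-close to `m`. -/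
def SNset (N : ℕ) (m ε : ℝ) : Finset (Fin N → Bool) :=
  Finset.univ.filter fun σ =>
    (N : ℝ)⁻¹ * (∑ i : Fin N, spin (σ i)) ∈ Set.Icc (m - ε) (m + ε)

/-- The restricted partition function `Z^{≤ε}_{N,β,m}`. -/
def Zres (N : ℕ) (β m ε : ℝ) (g : Fin N × Fin N → ℝ) : ℝ :=
  ∑ σ ∈ SNset N m ε, pm N m σ * Real.exp (ham N β m g σ)

/-- The quenched free energy `E[(1/N) log Z_{N,β,m}]`. -/
def F (N : ℕ) (β m : ℝ) : ℝ :=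
  ∫ g, (N : ℝ)⁻¹ * Real.log (Z N β m g) ∂(couplings N)

/-- The restricted quenched free energy `F^{≤ε}_{N,β,m} = E[(1/N) log Z^{≤ε}_{N,β,m}]`. -/
def Fres (N : ℕ) (β m ε : ℝ) : ℝ :=
  ∫ g, (N : ℝ)⁻¹ * Real.log (Zres N β m ε g) ∂(couplings N)

/-- The binary entropy function `I`. -/
def binEnt (s : ℝ) : ℝ :=
  -((1 + s) / 2) * Real.log ((1 + s) / 2) - ((1 - s) / 2) * Real.log ((1 - s) / 2)

/-- The centered Gaussian field `X_σ = (2N)^{-1/2} Σ_{ij} g_{ij} σ̂_i σ̂_j`. -/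
def Xg (N : ℕ) (m : ℝ) (g : Fin N × Fin N → ℝ) (σ : Fin N → Bool) : ℝ :=
  (Real.sqrt (2 * N))⁻¹ * ∑ i : Fin N, ∑ j : Fin N,
    g (i, j) * (spin (σ i) - m) * (spin (σ j) - m)

/-- The maximum `M_{N,m,ε} = max {X_σ : σ ∈ S_{N,m,ε}}`. -/
def Mmax (N : ℕ) (m ε : ℝ) (g : Fin N × Fin N → ℝ) : ℝ :=
  sSup ((fun σ => Xg N m g σ) '' (SNset N m ε : Set (Fin N → Bool)))

end

/-- The product of the centred spins at the two sites of `p`. -/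
def pairProd {N : ℕ} (m : ℝ) (σ : Fin N → Bool) (p : Fin N × Fin N) : ℝ :=
  (spin (σ p.1) - m) * (spin (σ p.2) - m)

/-- The squared length `∑ i, (σ_i - m)²` of the centred configuration. -/
def centeredSq {N : ℕ} (m : ℝ) (σ : Fin N → Bool) : ℝ :=
  ∑ i : Fin N, (spin (σ i) - m) ^ 2

instance isProbabilityMeasure_couplings (N : ℕ) : IsProbabilityMeasure (couplings N) := by
  unfold couplings; infer_instance

lemma weight_eq_exp {m : ℝ} (hm : m ∈ Set.Ioo (0 : ℝ) 1) (b : Bool) :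
    (1 + m * spin b) / 2 = Real.exp (-binEnt m +
      (spin b - m) / 2 * (Real.log ((1 + m) / 2) - Real.log ((1 - m) / 2))) := by
  obtain ⟨h0, h1⟩ := hm
  cases b
  · have : (1 + m * spin false) / 2 = (1 - m) / 2 := by simp [spin]; ring
    rw [this]
    nth_rewrite 1 [← Real.exp_log (show 0 < (1 - m) / 2 by linarith)]
    congr 1
    simp only [binEnt, spin, Bool.false_eq_true, if_false]
    ring
  · have : (1 + m * spin true) / 2 = (1 + m) / 2 := by simp [spin]
    rw [this]
    nth_rewrite 1 [← Real.exp_log (show 0 < (1 + m) / 2 by linarith)]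
    congr 1
    simp only [binEnt, spin, if_true]
    ring

lemma pm_eq_exp (N : ℕ) {m : ℝ} (hm : m ∈ Set.Ioo (0 : ℝ) 1) (σ : Fin N → Bool) :
    pm N m σ = Real.exp (-(N * binEnt m) + (∑ i, spin (σ i) - N * m) / 2 *
      (Real.log ((1 + m) / 2) - Real.log ((1 - m) / 2))) := by
  unfold pm
  simp_rw [weight_eq_exp hm]
  rw [← Real.exp_sum, Finset.sum_add_distrib, ← Finset.sum_mul, ← Finset.sum_div,
    Finset.sum_sub_distrib]
  simp

lemma pm_pos (N : ℕ) {m : ℝ} (hm : m ∈ Set.Ioo (0 : ℝ) 1) (σ : Fin N → Bool) :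
    0 < pm N m σ := by
  rw [pm_eq_exp N hm]; exact Real.exp_pos _

lemma sum_pm (N : ℕ) (m : ℝ) : ∑ σ : Fin N → Bool, pm N m σ = 1 := by
  have h := Finset.prod_univ_sum (fun _ : Fin N => (Finset.univ : Finset Bool))
    (fun _ b => (1 + m * spin b) / 2)
  rw [Fintype.piFinset_univ] at h
  unfold pm
  rw [← h]
  refine Finset.prod_eq_one fun i _ => ?_
  simp [spin]
  ring

lemma pow_le_pm (N : ℕ) {m : ℝ} (hm : m ∈ Set.Ioo (0 : ℝ) 1) (σ : Fin N → Bool) :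
    ((1 - m) / 2) ^ N ≤ pm N m σ := by
  obtain ⟨h0, h1⟩ := hm
  have h : ∏ _i : Fin N, ((1 - m) / 2) ≤ pm N m σ := by
    refine Finset.prod_le_prod (fun _ _ => by linarith) fun i _ => ?_
    cases σ i <;> simp [spin] <;> linarith
  rwa [Finset.prod_const, Finset.card_univ, Fintype.card_fin] at h

lemma centeredSq_eq {N : ℕ} (m : ℝ) (σ : Fin N → Bool) :
    centeredSq m σ = N * (1 + m ^ 2) - 2 * m * ∑ i, spin (σ i) := by
  have h : ∀ b, (spin b - m) ^ 2 = (1 + m ^ 2) - 2 * m * spin b := by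
    intro b; cases b <;> simp [spin] <;> ring
  unfold centeredSq
  simp_rw [h]
  rw [Finset.sum_sub_distrib, ← Finset.mul_sum]
  simp [mul_add]

lemma centeredSq_nonneg {N : ℕ} (m : ℝ) (σ : Fin N → Bool) : 0 ≤ centeredSq m σ :=
  Finset.sum_nonneg fun _ _ => sq_nonneg _

lemma centeredSq_le {N : ℕ} {m : ℝ} (hm : m ∈ Set.Ioo (0 : ℝ) 1) (σ : Fin N → Bool) :
    centeredSq m σ ≤ 4 * N := by
  obtain ⟨h0, h1⟩ := hm
  have h : centeredSq m σ ≤ ∑ _i : Fin N, (4 : ℝ) := by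
    refine Finset.sum_le_sum fun i _ => ?_
    cases σ i <;> simp [spin] <;> nlinarith
  refine h.trans_eq ?_
  simp [mul_comm]

lemma sum_pairProd_sq {N : ℕ} (m : ℝ) (σ : Fin N → Bool) :
    ∑ p, pairProd m σ p ^ 2 = centeredSq m σ ^ 2 := by
  rw [Fintype.sum_prod_type, sq (centeredSq m σ)]
  unfold centeredSq
  rw [Finset.sum_mul_sum]
  simp [pairProd, mul_pow]

lemma ham_eq (N : ℕ) (β m : ℝ) (g : Fin N × Fin N → ℝ) (σ : Fin N → Bool) :
    ham N β m g σ = ∑ p, (β / Real.sqrt 2 * pairProd m σ p) * g p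
      - β ^ 2 / (4 * N) * centeredSq m σ ^ 2 := by
  rw [← sum_pairProd_sq, Fintype.sum_prod_type, Fintype.sum_prod_type]
  unfold ham pairProd
  simp only [Finset.mul_sum, mul_pow]
  congr 1
  refine Finset.sum_congr rfl fun i _ => Finset.sum_congr rfl fun j _ => ?_
  ring

lemma integrable_exp_linear (N : ℕ) (c : Fin N × Fin N → ℝ) :
    Integrable (fun g => Real.exp (∑ p, c p * g p)) (couplings N) := by
  simp_rw [Real.exp_sum]
  exact Integrable.fintype_prod fun p => integrable_exp_mul_gaussianReal (c p)

lemma integral_exp_linear (N : ℕ) (c : Fin N × Fin N → ℝ) :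
    ∫ g, Real.exp (∑ p, c p * g p) ∂(couplings N) =
      Real.exp ((N : ℝ)⁻¹ / 2 * ∑ p, c p ^ 2) := by
  simp_rw [Real.exp_sum]
  unfold couplings
  rw [integral_fintype_prod_eq_prod (fun p x => Real.exp (c p * x)), Finset.mul_sum, Real.exp_sum]
  refine Finset.prod_congr rfl fun p _ => ?_
  have h := congrFun (mgf_fun_id_gaussianReal (μ := 0) (v := (N : ℝ≥0)⁻¹)) (c p)
  simp only [mgf] at h
  rw [h]
  congr 1
  push_cast
  ring

lemma integrable_linear (N : ℕ) (c : Fin N × Fin N → ℝ) :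
    Integrable (fun g => ∑ p, c p * g p) (couplings N) := by
  refine integrable_finsetSum _ fun p _ => Integrable.const_mul ?_ _
  exact integrable_comp_eval (f := id)
    ((memLp_id_gaussianReal (μ := 0) (v := (N : ℝ≥0)⁻¹) 1).integrable (by simp))

lemma integral_linear (N : ℕ) (c : Fin N × Fin N → ℝ) :
    ∫ g, ∑ p, c p * g p ∂(couplings N) = 0 := by
  have hI (p) : Integrable (fun g : Fin N × Fin N → ℝ => g p) (couplings N) :=
    integrable_comp_eval (f := id)
      ((memLp_id_gaussianReal (μ := 0) (v := (N : ℝ≥0)⁻¹) 1).integrable (by simp))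
  rw [integral_finsetSum _ fun p _ => (hI p).const_mul _]
  refine Finset.sum_eq_zero fun p _ => ?_
  rw [integral_const_mul]
  have h : ∫ g : Fin N × Fin N → ℝ, id (g p) ∂(couplings N) =
      ∫ x, id x ∂gaussianReal 0 (N : ℝ≥0)⁻¹ :=
    integral_comp_eval (i := p) (by fun_prop)
  simp only [id] at h
  rw [h, integral_id_gaussianReal, mul_zero]

lemma integrable_ham (N : ℕ) (β m : ℝ) (σ : Fin N → Bool) :
    Integrable (fun g => ham N β m g σ) (couplings N) := by
  simp_rw [ham_eq]
  exact (integrable_linear N _).sub (integrable_const _)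

lemma integral_ham (N : ℕ) (β m : ℝ) (σ : Fin N → Bool) :
    ∫ g, ham N β m g σ ∂(couplings N) = -(β ^ 2 / (4 * N) * centeredSq m σ ^ 2) := by
  simp_rw [ham_eq]
  rw [integral_sub (integrable_linear N _) (integrable_const _), integral_linear]
  simp

lemma exp_mul_ham (N : ℕ) (β m θ : ℝ) (g : Fin N × Fin N → ℝ) (σ : Fin N → Bool) :
    Real.exp (θ * ham N β m g σ) =
      Real.exp (∑ p, (θ * (β / Real.sqrt 2) * pairProd m σ p) * g p) *
        Real.exp (-(θ * (β ^ 2 / (4 * N)) * centeredSq m σ ^ 2)) := by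
  rw [ham_eq, ← Real.exp_add, mul_sub, Finset.mul_sum]
  congr 1
  simp only [sub_eq_add_neg, mul_assoc]

lemma integrable_exp_mul_ham (N : ℕ) (β m θ : ℝ) (σ : Fin N → Bool) :
    Integrable (fun g => Real.exp (θ * ham N β m g σ)) (couplings N) := by
  simp_rw [exp_mul_ham]
  exact (integrable_exp_linear N _).mul_const _

lemma integral_exp_mul_ham (N : ℕ) (β m θ : ℝ) (σ : Fin N → Bool) :
    ∫ g, Real.exp (θ * ham N β m g σ) ∂(couplings N) =
      Real.exp ((θ ^ 2 - θ) * (β ^ 2 / (4 * N)) * centeredSq m σ ^ 2) := by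
  simp_rw [exp_mul_ham]
  rw [integral_mul_const, integral_exp_linear, ← Real.exp_add]
  simp_rw [mul_pow]
  rw [← Finset.mul_sum, sum_pairProd_sq, div_pow, Real.sq_sqrt (by norm_num)]
  congr 1
  rcases Nat.eq_zero_or_pos N with rfl | hN
  · simp
  · field_simp
    ring

lemma zres_pos (N : ℕ) (β : ℝ) {m ε : ℝ} (hm : m ∈ Set.Ioo (0 : ℝ) 1)
    (hS : (SNset N m ε).Nonempty) (g : Fin N × Fin N → ℝ) : 0 < Zres N β m ε g :=
  Finset.sum_pos (fun σ _ => mul_pos (pm_pos N hm σ) (Real.exp_pos _)) hS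

lemma integrable_zres (N : ℕ) (β m ε : ℝ) :
    Integrable (fun g => Zres N β m ε g) (couplings N) := by
  unfold Zres
  refine integrable_finsetSum _ fun σ _ => Integrable.const_mul ?_ _
  simpa using integrable_exp_mul_ham N β m 1 σ

lemma log_pm_add_ham_le_log_zres (N : ℕ) (β : ℝ) {m ε : ℝ} (hm : m ∈ Set.Ioo (0 : ℝ) 1)
    {σ : Fin N → Bool} (hσ : σ ∈ SNset N m ε) (g : Fin N × Fin N → ℝ) :
    Real.log (pm N m σ) + ham N β m g σ ≤ Real.log (Zres N β m ε g) := by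
  have h := pm_pos N hm σ
  rw [← Real.log_exp (ham N β m g σ), ← Real.log_mul h.ne' (Real.exp_pos _).ne']
  refine Real.log_le_log (mul_pos h (Real.exp_pos _)) ?_
  exact Finset.single_le_sum (f := fun τ => pm N m τ * Real.exp (ham N β m g τ))
    (fun τ _ => (mul_pos (pm_pos N hm τ) (Real.exp_pos _)).le) hσ

lemma integrable_log_zres (N : ℕ) (β : ℝ) {m ε : ℝ} (hm : m ∈ Set.Ioo (0 : ℝ) 1)
    (hS : (SNset N m ε).Nonempty) :
    Integrable (fun g => Real.log (Zres N β m ε g)) (couplings N) := by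
  obtain ⟨σ, hσ⟩ := hS
  have hZ := integrable_zres N β m ε
  refine integrable_of_le_of_le
    (Real.measurable_log.comp_aemeasurable hZ.aemeasurable).aestronglyMeasurable
    (Eventually.of_forall fun g => log_pm_add_ham_le_log_zres N β hm hσ g)
    (Eventually.of_forall fun g => Real.log_le_self (zres_pos N β hm ⟨σ, hσ⟩ g).le)
    ((integrable_const _).add (integrable_ham N β m σ)) hZ

lemma le_fres {N : ℕ} (hN : 0 < N) (β : ℝ) {m ε : ℝ} (hm : m ∈ Set.Ioo (0 : ℝ) 1)
    (hS : (SNset N m ε).Nonempty) :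
    Real.log ((1 - m) / 2) - 4 * β ^ 2 ≤ Fres N β m ε := by
  obtain ⟨σ, hσ⟩ := hS
  have hN' : (0 : ℝ) < N := by exact_mod_cast hN
  unfold Fres
  rw [integral_const_mul]
  have h1 := integral_mono ((integrable_const (Real.log (pm N m σ))).add (integrable_ham N β m σ))
    (integrable_log_zres N β hm ⟨σ, hσ⟩) (fun g => log_pm_add_ham_le_log_zres N β hm hσ g)
  simp only [Pi.add_apply] at h1
  rw [integral_add (integrable_const _) (integrable_ham N β m σ), integral_ham] at h1
  simp only [integral_const, probReal_univ, one_smul] at h1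
  have h2 : N * Real.log ((1 - m) / 2) ≤ Real.log (pm N m σ) := by
    rw [← Real.log_pow]
    exact Real.log_le_log (pow_pos (by linarith [hm.2]) _) (pow_le_pm N hm σ)
  have h3 : β ^ 2 / (4 * N) * centeredSq m σ ^ 2 ≤ N * (4 * β ^ 2) := by
    calc β ^ 2 / (4 * N) * centeredSq m σ ^ 2 ≤ β ^ 2 / (4 * N) * (4 * N) ^ 2 := by
          gcongr
          exacts [centeredSq_nonneg m σ, centeredSq_le hm σ]
      _ = N * (4 * β ^ 2) := by field_simp
  rw [le_inv_mul_iff₀ hN']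
  linarith

lemma log_sum_le {ι : Type*} (s : Finset ι) (hs : s.Nonempty) (a : ι → ℝ) (ha : ∀ i ∈ s, 0 < a i)
    {θ : ℝ} (h0 : 0 < θ) (h1 : θ ≤ 1) :
    Real.log (∑ i ∈ s, a i) ≤ θ⁻¹ * Real.log (∑ i ∈ s, a i ^ θ) := by
  have hA : 0 < ∑ i ∈ s, a i := Finset.sum_pos ha hs
  have key : (∑ i ∈ s, a i) ^ θ ≤ ∑ i ∈ s, a i ^ θ := by
    have h : 1 ≤ ∑ i ∈ s, (a i / ∑ j ∈ s, a j) ^ θ := by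
      calc (1 : ℝ) = ∑ i ∈ s, a i / ∑ j ∈ s, a j := by
            rw [← Finset.sum_div, div_self hA.ne']
        _ ≤ _ := by
          refine Finset.sum_le_sum fun i hi => ?_
          refine Real.self_le_rpow_of_le_one (div_pos (ha i hi) hA).le ?_ h1
          rw [div_le_one hA]
          exact Finset.single_le_sum (fun j hj => (ha j hj).le) hi
    rw [Finset.sum_congr rfl fun i hi => Real.div_rpow (ha i hi).le hA.le θ, ← Finset.sum_div,
      one_le_div (Real.rpow_pos_of_pos hA _)] at h
    exact h
  rw [le_inv_mul_iff₀ h0, ← Real.log_rpow hA]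
  exact Real.log_le_log (Real.rpow_pos_of_pos hA _) key

lemma mem_SNset {N : ℕ} (hN : 0 < N) {m ε : ℝ} {σ : Fin N → Bool} :
    σ ∈ SNset N m ε ↔ |∑ i, spin (σ i) - N * m| ≤ N * ε := by
  have hN' : (0 : ℝ) < N := by exact_mod_cast hN
  simp only [SNset, Finset.mem_filter, Finset.mem_univ, true_and, Set.mem_Icc]
  rw [le_inv_mul_iff₀ hN', inv_mul_le_iff₀ hN', abs_le]
  constructor <;> rintro ⟨h1, h2⟩ <;> constructor <;> linarith

/-- Fractional-moment bound for the weight of one configuration near magnetization `m`. -/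
lemma integral_rpow_le {N : ℕ} (hN : 0 < N) (β : ℝ) {m ε θ : ℝ} (hm : m ∈ Set.Ioo (0 : ℝ) 1)
    (hε : 2 * m * ε ≤ 1 - m ^ 2) (h0 : 0 < θ) (h1 : θ ≤ 1)
    {σ : Fin N → Bool} (hσ : σ ∈ SNset N m ε) :
    ∫ g, (pm N m σ * Real.exp (ham N β m g σ)) ^ θ ∂(couplings N) ≤
      pm N m σ * Real.exp (N * ((1 - θ) * (binEnt m +
        ε / 2 * (Real.log ((1 + m) / 2) - Real.log ((1 - m) / 2))
          - θ * β ^ 2 / 4 * (1 - m ^ 2 - 2 * m * ε) ^ 2))) := by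
  have hN' : (0 : ℝ) < N := by exact_mod_cast hN
  have hp := pm_pos N hm σ
  have habs := abs_le.1 ((mem_SNset hN).1 hσ)
  simp_rw [Real.mul_rpow hp.le (Real.exp_pos _).le, ← Real.exp_mul, mul_comm _ θ]
  rw [integral_const_mul, integral_exp_mul_ham]
  have hL : 0 ≤ Real.log ((1 + m) / 2) - Real.log ((1 - m) / 2) :=
    sub_nonneg.2 (Real.log_le_log (by linarith [hm.2]) (by linarith [hm.1]))
  have hpθ : pm N m σ ^ θ ≤ pm N m σ * Real.exp (N * ((1 - θ) * (binEnt m +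
        ε / 2 * (Real.log ((1 + m) / 2) - Real.log ((1 - m) / 2))))) := by
    rw [pm_eq_exp N hm σ, ← Real.exp_mul, ← Real.exp_add]
    refine Real.exp_le_exp.2 ?_
    have := mul_nonneg (mul_nonneg (sub_nonneg.2 h1) hL)
      (show 0 ≤ ∑ i, spin (σ i) - N * m + N * ε by linarith)
    nlinarith
  have hb : (N * (1 - m ^ 2 - 2 * m * ε)) ^ 2 ≤ centeredSq m σ ^ 2 := by
    refine pow_le_pow_left₀ (mul_nonneg hN'.le (by linarith)) ?_ 2
    rw [centeredSq_eq]
    nlinarith [mul_le_mul_of_nonneg_left habs.2 hm.1.le]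
  calc _ ≤ (pm N m σ * Real.exp (N * ((1 - θ) * (binEnt m +
        ε / 2 * (Real.log ((1 + m) / 2) - Real.log ((1 - m) / 2)))))) *
        Real.exp (-(N * ((1 - θ) * (θ * β ^ 2 / 4 * (1 - m ^ 2 - 2 * m * ε) ^ 2)))) := by
        refine mul_le_mul hpθ (Real.exp_le_exp.2 ?_) (Real.exp_pos _).le (by positivity)
        have h2 := mul_le_mul_of_nonneg_left hb
          (show 0 ≤ θ * (1 - θ) * (β ^ 2 / (4 * N)) from
            mul_nonneg (mul_nonneg h0.le (sub_nonneg.2 h1)) (by positivity))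
        have h3 : θ * (1 - θ) * (β ^ 2 / (4 * N)) * (N * (1 - m ^ 2 - 2 * m * ε)) ^ 2
            = N * ((1 - θ) * (θ * β ^ 2 / 4 * (1 - m ^ 2 - 2 * m * ε) ^ 2)) := by
          field_simp
        nlinarith
    _ = _ := by
        rw [mul_assoc, ← Real.exp_add]
        congr 2
        ring

lemma fres_le {N : ℕ} (hN : 0 < N) (β : ℝ) {m ε θ : ℝ} (hm : m ∈ Set.Ioo (0 : ℝ) 1)
    (hε : 2 * m * ε ≤ 1 - m ^ 2) (h0 : 0 < θ) (h1 : θ ≤ 1) (hS : (SNset N m ε).Nonempty) :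
    Fres N β m ε ≤ θ⁻¹ * ((1 - θ) * (binEnt m +
        ε / 2 * (Real.log ((1 + m) / 2) - Real.log ((1 - m) / 2))
          - θ * β ^ 2 / 4 * (1 - m ^ 2 - 2 * m * ε) ^ 2)) := by
  have hN' : (0 : ℝ) < N := by exact_mod_cast hN
  set K := (1 - θ) * (binEnt m +
        ε / 2 * (Real.log ((1 + m) / 2) - Real.log ((1 - m) / 2))
          - θ * β ^ 2 / 4 * (1 - m ^ 2 - 2 * m * ε) ^ 2) with hK
  set W : (Fin N × Fin N → ℝ) → ℝ := fun g =>
    ∑ σ ∈ SNset N m ε, (pm N m σ * Real.exp (ham N β m g σ)) ^ θ with hW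
  have hWi (σ : Fin N → Bool) :
      Integrable (fun g => (pm N m σ * Real.exp (ham N β m g σ)) ^ θ) (couplings N) := by
    simp_rw [Real.mul_rpow (pm_pos N hm σ).le (Real.exp_pos _).le, ← Real.exp_mul, mul_comm _ θ]
    exact (integrable_exp_mul_ham N β m θ σ).const_mul _
  have hWint : Integrable W (couplings N) := integrable_finsetSum _ fun σ _ => hWi σ
  have hEW : ∫ g, W g ∂(couplings N) ≤ Real.exp (N * K) := by
    rw [hW, integral_finsetSum _ fun σ _ => hWi σ]
    calc _ ≤ ∑ σ ∈ SNset N m ε, pm N m σ * Real.exp (N * K) :=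
          Finset.sum_le_sum fun σ hσ => integral_rpow_le hN β hm hε h0 h1 hσ
      _ ≤ 1 * Real.exp (N * K) := by
          rw [← Finset.sum_mul, ← sum_pm N m]
          exact mul_le_mul_of_nonneg_right (Finset.sum_le_sum_of_subset_of_nonneg
            (Finset.subset_univ _) fun σ _ _ => (pm_pos N hm σ).le) (Real.exp_pos _).le
      _ = _ := one_mul _
  have hpt (g) : Real.log (Zres N β m ε g) ≤
      θ⁻¹ * (N * K + (W g * Real.exp (-(N * K)) - 1)) := by
    have hpos : ∀ σ ∈ SNset N m ε, 0 < pm N m σ * Real.exp (ham N β m g σ) :=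
      fun σ _ => mul_pos (pm_pos N hm σ) (Real.exp_pos _)
    refine (log_sum_le _ hS _ hpos h0 h1).trans ?_
    refine mul_le_mul_of_nonneg_left ?_ (inv_nonneg.2 h0.le)
    have hWpos : 0 < W g := Finset.sum_pos (fun σ hσ => Real.rpow_pos_of_pos (hpos σ hσ) _) hS
    have := Real.log_le_sub_one_of_pos (mul_pos hWpos (Real.exp_pos (-(N * K))))
    rw [Real.log_mul hWpos.ne' (Real.exp_pos _).ne', Real.log_exp] at this
    simp only [hW] at this ⊢
    linarith
  have hWc : Integrable (fun g => W g * Real.exp (-(N * K))) (couplings N) := hWint.mul_const _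
  have hWd : Integrable (fun g => W g * Real.exp (-(N * K)) - 1) (couplings N) :=
    hWc.sub (integrable_const 1)
  have hI := integral_mono (integrable_log_zres N β hm hS)
    (((integrable_const (N * K)).add hWd).const_mul θ⁻¹) hpt
  simp only [Pi.add_apply] at hI
  rw [integral_const_mul, integral_add (integrable_const _) hWd,
    integral_sub hWc (integrable_const 1)] at hI
  simp only [integral_const, probReal_univ, one_smul] at hI
  have h3 : ∫ g, W g * Real.exp (-(N * K)) ∂(couplings N) ≤ 1 := by
    rw [integral_mul_const]
    calc _ ≤ Real.exp (N * K) * Real.exp (-(N * K)) :=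
          mul_le_mul_of_nonneg_right hEW (Real.exp_pos _).le
      _ = 1 := by rw [← Real.exp_add]; simp
  unfold Fres
  rw [integral_const_mul, inv_mul_le_iff₀ hN']
  refine hI.trans ?_
  calc _ ≤ θ⁻¹ * (N * K) := mul_le_mul_of_nonneg_left (by linarith) (inv_nonneg.2 h0.le)
    _ = _ := by ring

lemma sum_spin_lt {N k : ℕ} (hk : k ≤ N) :
    ∑ i : Fin N, spin (decide ((i : ℕ) < k)) = 2 * k - N := by
  rw [Fin.sum_univ_eq_sum_range (fun i => spin (decide (i < k))) N,
    ← Finset.sum_range_add_sum_Ico _ hk,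
    Finset.sum_congr rfl fun i hi => show spin (decide (i < k)) = 1 by
      simp [spin, Finset.mem_range.1 hi],
    Finset.sum_congr (s₁ := Finset.Ico k N) rfl fun i hi => show spin (decide (i < k)) = -1 by
      simp [spin, (Finset.mem_Ico.1 hi).1]]
  simp [Nat.cast_sub hk]
  ring

lemma eventually_SNset_nonempty {m ε : ℝ} (hm : m ∈ Set.Ioo (0 : ℝ) 1) (hε : 0 < ε) :
    ∀ᶠ N : ℕ in atTop, 0 < N ∧ (SNset N m ε).Nonempty := by
  filter_upwards [eventually_gt_atTop 0, eventually_ge_atTop ⌈2 / ε⌉₊] with N hN hN2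
  have hN' : (0 : ℝ) < N := by exact_mod_cast hN
  refine ⟨hN, ?_⟩
  have h2 : 2 ≤ N * ε := by
    rw [← div_le_iff₀ hε]
    exact (Nat.le_ceil _).trans (by exact_mod_cast hN2)
  have hx : 0 ≤ N * (1 + m) / 2 := by have := hm.1; positivity
  have hf1 := Nat.floor_le hx
  have hf2 := Nat.lt_floor_add_one (N * (1 + m) / 2)
  have hk : ⌊N * (1 + m) / 2⌋₊ ≤ N := by
    have : (⌊N * (1 + m) / 2⌋₊ : ℝ) ≤ N := hf1.trans (by nlinarith [hm.2])
    exact_mod_cast this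
  refine ⟨fun i => decide ((i : ℕ) < ⌊N * (1 + m) / 2⌋₊), (mem_SNset hN).2 ?_⟩
  rw [sum_spin_lt hk, abs_le]
  constructor <;> linarith

lemma limsup_fres_le (β : ℝ) {m θ : ℝ} (hm : m ∈ Set.Ioo (0 : ℝ) 1) (h0 : 0 < θ) (h1 : θ ≤ 1) :
    limsup (fun ε : ℝ => limsup (fun N : ℕ => Fres N β m ε) atTop) (nhdsWithin 0 (Set.Ioi 0)) ≤
      θ⁻¹ * ((1 - θ) * (binEnt m - θ * β ^ 2 / 4 * (1 - m ^ 2) ^ 2)) := by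
  set G : ℝ → ℝ := fun ε => θ⁻¹ * ((1 - θ) * (binEnt m +
        ε / 2 * (Real.log ((1 + m) / 2) - Real.log ((1 - m) / 2))
          - θ * β ^ 2 / 4 * (1 - m ^ 2 - 2 * m * ε) ^ 2)) with hG
  have hlim : Tendsto G (nhdsWithin 0 (Set.Ioi 0))
      (nhds (θ⁻¹ * ((1 - θ) * (binEnt m - θ * β ^ 2 / 4 * (1 - m ^ 2) ^ 2)))) := by
    have : Continuous G := by fun_prop
    have h := this.tendsto 0
    simp only [hG, zero_div, zero_mul, add_zero, mul_zero, sub_zero] at h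
    exact h.mono_left nhdsWithin_le_nhds
  have ha : 0 < 1 - m ^ 2 := by nlinarith [hm.1, hm.2]
  have hsmall : ∀ᶠ ε : ℝ in nhdsWithin 0 (Set.Ioi 0), 0 < ε ∧ 2 * m * ε ≤ 1 - m ^ 2 := by
    have hc : Tendsto (fun ε : ℝ => 2 * m * ε) (nhdsWithin 0 (Set.Ioi 0)) (nhds 0) := by
      have : Continuous (fun ε : ℝ => 2 * m * ε) := by fun_prop
      have h := this.tendsto 0
      rw [mul_zero] at h
      exact h.mono_left nhdsWithin_le_nhds
    filter_upwards [self_mem_nhdsWithin, hc.eventually_le_const ha] with ε h2 h3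
    exact ⟨h2, h3⟩
  have hlower (ε : ℝ) (hε : 0 < ε) :
      ∀ᶠ N : ℕ in atTop, Real.log ((1 - m) / 2) - 4 * β ^ 2 ≤ Fres N β m ε := by
    filter_upwards [eventually_SNset_nonempty hm hε] with N hN
    exact le_fres hN.1 β hm hN.2
  have hupper (ε : ℝ) (hε : 0 < ε) (hε' : 2 * m * ε ≤ 1 - m ^ 2) :
      ∀ᶠ N : ℕ in atTop, Fres N β m ε ≤ G ε := by
    filter_upwards [eventually_SNset_nonempty hm hε] with N hN
    exact fres_le hN.1 β hm hε' h0 h1 hN.2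
  rw [← hlim.limsup_eq]
  refine limsup_le_limsup ?_ ?_ hlim.isBoundedUnder_le
  · filter_upwards [hsmall] with ε hε
    exact limsup_le_of_le (isBoundedUnder_of_eventually_ge (hlower ε hε.1)).isCoboundedUnder_le
      (hupper ε hε.1 hε.2)
  · refine IsBoundedUnder.isCoboundedUnder_le
      (isBoundedUnder_of_eventually_ge (a := Real.log ((1 - m) / 2) - 4 * β ^ 2) ?_)
    filter_upwards [hsmall] with ε hε
    exact le_limsup_of_frequently_le (hlower ε hε.1).frequently
      (isBoundedUnder_of_eventually_le (hupper ε hε.1 hε.2))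

lemma binEnt_pos {m : ℝ} (hm : m ∈ Set.Ioo (0 : ℝ) 1) : 0 < binEnt m := by
  obtain ⟨h0, h1⟩ := hm
  have h2 : Real.log ((1 + m) / 2) < 0 := Real.log_neg (by linarith) (by linarith)
  have h3 : Real.log ((1 - m) / 2) < 0 := Real.log_neg (by linarith) (by linarith)
  unfold binEnt
  nlinarith [mul_pos (show 0 < (1 + m) / 2 by linarith) (neg_pos.2 h2),
    mul_pos (show 0 < (1 - m) / 2 by linarith) (neg_pos.2 h3)]

/-- with `β_c = 2 (1-m²)⁻¹ √(I(m))`, the iterated limsup of the restricted free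
energy is `≤ 0` for `β < β_c` and `≤ -(1/4)(β-β_c)²(1-m²)²` for `β ≥ β_c`. -/
theorem statement4 (m : ℝ) (hm : m ∈ Set.Ioo (0 : ℝ) 1) (β : ℝ) (hβ : 0 ≤ β) :
    (β < 2 * (1 - m ^ 2)⁻¹ * Real.sqrt (binEnt m) →
      limsup (fun ε : ℝ => limsup (fun N : ℕ => Fres N β m ε) atTop)
          (nhdsWithin 0 (Set.Ioi 0)) ≤ 0) ∧
    (2 * (1 - m ^ 2)⁻¹ * Real.sqrt (binEnt m) ≤ β →
      limsup (fun ε : ℝ => limsup (fun N : ℕ => Fres N β m ε) atTop)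
          (nhdsWithin 0 (Set.Ioi 0)) ≤
        -(1 / 4) * (β - 2 * (1 - m ^ 2)⁻¹ * Real.sqrt (binEnt m)) ^ 2 * (1 - m ^ 2) ^ 2) := by
  refine ⟨fun _ => ?_, fun hc => ?_⟩
  · simpa using limsup_fres_le β hm one_pos le_rfl
  · have ha : 0 < 1 - m ^ 2 := by nlinarith [hm.1, hm.2]
    have hI := binEnt_pos hm
    set βc := 2 * (1 - m ^ 2)⁻¹ * Real.sqrt (binEnt m) with hβc
    have hβc0 : 0 < βc := by positivity
    have hβ0 : 0 < β := hβc0.trans_le hc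
    have hent : binEnt m = βc ^ 2 * (1 - m ^ 2) ^ 2 / 4 := by
      rw [hβc, mul_pow, mul_pow, Real.sq_sqrt hI.le]
      field_simp
      norm_num
    refine (limsup_fres_le β hm (div_pos hβc0 hβ0) ((div_le_one hβ0).2 hc)).trans_eq ?_
    rw [hent]
    field_simp
    ring
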